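/- Strong composition for Rényi divergence: for α > 1 and random vectors (X₁, …, X_k) and (Y₁, …, Y_k), D_α(P_{X_{1:k}} ‖ P_{Y_{1:k}}) ≤ ∑_{i=1}^k sup over histories x_{1:i−1} of D_α(P_{X_i | X_{1:i−1}=x_{1:i−1}} ‖ P_{Y_i | Y_{1:i−1}=x_{1:i−1}}). -/

import Mathlib

open MeasureTheory ProbabilityTheory
open scoped NNReal ENNReal

open scoped Classical in
/-- Rényi divergence of order `α`: `(α-1)⁻¹ log ∫ (dμ/dν)^α dν` for `α ≠ 1` (with the
KL divergence as the `α = 1` case), and `⊤` when `μ` is not absolutely continuous w.r.t. `ν`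
or the defining integral is infinite. -/
noncomputable def renyiDiv {Ω : Type*} [MeasurableSpace Ω] (α : ℝ) (μ ν : Measure Ω) : EReal :=
  if μ ≪ ν then
    if α = 1 then ((∫ x, Real.log ((μ.rnDeriv ν x).toReal) ∂μ : ℝ) : EReal)
    else if (∫⁻ x, (μ.rnDeriv ν x) ^ α ∂ν) = ∞ then ⊤
    else (((α - 1)⁻¹ * Real.log ((∫⁻ x, (μ.rnDeriv ν x) ^ α ∂ν).toReal) : ℝ) : EReal)
  else ⊤

section Moment

variable {α β : Type*} {mα : MeasurableSpace α} {mβ : MeasurableSpace β}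

/-- The integral `∫ (dμ/dν)^p dν` appearing in the Rényi divergence of order `p`. -/
noncomputable def renyiMoment (p : ℝ) (μ ν : Measure α) : ℝ≥0∞ :=
  ∫⁻ x, (μ.rnDeriv ν x) ^ p ∂ν

lemma renyiMoment_self {p : ℝ} (μ : Measure α) [IsProbabilityMeasure μ] :
    renyiMoment p μ μ = 1 := by
  rw [renyiMoment, lintegral_congr_ae (g := fun _ ↦ 1)]
  · simp
  · filter_upwards [μ.rnDeriv_self] with x hx
    simp [hx]

lemma renyiMoment_map {p : ℝ} (μ ν : Measure α) [SigmaFinite μ] [SigmaFinite ν] {f : α → β}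
    (hf : MeasurableEmbedding f) : renyiMoment p (μ.map f) (ν.map f) = renyiMoment p μ ν := by
  rw [renyiMoment, renyiMoment, hf.lintegral_map]
  refine lintegral_congr_ae ?_
  filter_upwards [hf.rnDeriv_map μ ν] with x hx
  rw [hx]

lemma renyiMoment_ne_zero {p : ℝ} (hp : 0 < p) {μ ν : Measure α} [NeZero μ] [SigmaFinite μ]
    [SigmaFinite ν] (h : μ ≪ ν) : renyiMoment p μ ν ≠ 0 := by
  intro h0
  rw [renyiMoment, lintegral_eq_zero_iff (by fun_prop)] at h0
  have hz : μ.rnDeriv ν =ᵐ[ν] 0 := by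
    filter_upwards [h0] with x hx
    simpa [ENNReal.rpow_eq_zero_iff_of_pos hp] using hx
  apply NeZero.ne μ
  rw [← Measure.withDensity_rnDeriv_eq μ ν h, withDensity_congr_ae hz, withDensity_zero]

lemma compProd_eq_withDensity_rnDeriv_mul [MeasurableSpace.CountableOrCountablyGenerated α β]
    {μ ν : Measure α} [SigmaFinite μ] [SigmaFinite ν] {κ η : Kernel α β} [IsFiniteKernel κ]
    [IsFiniteKernel η] (hμν : μ ≪ ν) (hκη : ∀ a, κ a ≪ η a) :
    μ ⊗ₘ κ =
      (ν ⊗ₘ η).withDensity (fun x ↦ μ.rnDeriv ν x.1 * Kernel.rnDeriv κ η x.1 x.2) := by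
  have hg : Measurable (fun x : α × β ↦ Kernel.rnDeriv κ η x.1 x.2) :=
    Kernel.measurable_rnDeriv κ η
  ext s hs
  rw [withDensity_apply _ hs, ← lintegral_indicator hs,
    Measure.lintegral_compProd (Measurable.indicator (by fun_prop) hs), Measure.compProd_apply hs]
  conv_lhs => rw [← Measure.withDensity_rnDeriv_eq μ ν hμν]
  rw [lintegral_withDensity_eq_lintegral_mul _ (by fun_prop)
    (Kernel.measurable_kernel_prodMk_left hs)]
  refine lintegral_congr fun a ↦ ?_
  have hsa : MeasurableSet (Prod.mk a ⁻¹' s) := measurable_prodMk_left hs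
  have h1 : κ a (Prod.mk a ⁻¹' s) =
      ∫⁻ b, (Prod.mk a ⁻¹' s).indicator (Kernel.rnDeriv κ η a) b ∂η a := by
    conv_lhs => rw [← Kernel.withDensity_rnDeriv_eq (hκη a)]
    rw [Kernel.withDensity_apply _ (Kernel.measurable_rnDeriv κ η), withDensity_apply _ hsa,
      lintegral_indicator hsa]
  rw [Pi.mul_apply, h1, ← lintegral_const_mul _
    ((Kernel.measurable_rnDeriv_right κ η a).indicator hsa)]
  refine lintegral_congr fun b ↦ ?_
  by_cases hb : (a, b) ∈ s <;> simp [Set.indicator, hb]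

lemma renyiMoment_compProd_le [MeasurableSpace.CountableOrCountablyGenerated α β]
    {p : ℝ} (hp : 0 ≤ p) {μ ν : Measure α} [SigmaFinite μ] [IsFiniteMeasure ν]
    {κ η : Kernel α β} [IsFiniteKernel κ] [IsFiniteKernel η] (hμν : μ ≪ ν)
    (hκη : ∀ a, κ a ≪ η a) {C : ℝ≥0∞} (hC : ∀ a, renyiMoment p (κ a) (η a) ≤ C) :
    renyiMoment p (μ ⊗ₘ κ) (ν ⊗ₘ η) ≤ renyiMoment p μ ν * C := by
  have hg : Measurable (fun x : α × β ↦ Kernel.rnDeriv κ η x.1 x.2) :=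
    Kernel.measurable_rnDeriv κ η
  have hd : (μ ⊗ₘ κ).rnDeriv (ν ⊗ₘ η) =ᵐ[ν ⊗ₘ η]
      fun x ↦ μ.rnDeriv ν x.1 * Kernel.rnDeriv κ η x.1 x.2 := by
    rw [compProd_eq_withDensity_rnDeriv_mul hμν hκη]
    exact Measure.rnDeriv_withDensity _ (by fun_prop)
  calc renyiMoment p (μ ⊗ₘ κ) (ν ⊗ₘ η)
      = ∫⁻ x, (μ.rnDeriv ν x.1 * Kernel.rnDeriv κ η x.1 x.2) ^ p ∂(ν ⊗ₘ η) := by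
        refine lintegral_congr_ae ?_
        filter_upwards [hd] with x hx
        rw [hx]
    _ = ∫⁻ a, (μ.rnDeriv ν a) ^ p * renyiMoment p (κ a) (η a) ∂ν := by
        rw [Measure.lintegral_compProd (by fun_prop)]
        refine lintegral_congr fun a ↦ ?_
        simp_rw [ENNReal.mul_rpow_of_nonneg _ _ hp]
        rw [lintegral_const_mul _ ((Kernel.measurable_rnDeriv_right κ η a).pow_const p)]
        congr 1
        refine lintegral_congr_ae ?_
        filter_upwards [Kernel.rnDeriv_eq_rnDeriv_measure (κ := κ) (η := η) (a := a)] with b hb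
        rw [hb]
    _ ≤ ∫⁻ a, (μ.rnDeriv ν a) ^ p * C ∂ν := by
        gcongr with a
        exact hC a
    _ = renyiMoment p μ ν * C := lintegral_mul_const _ (by fun_prop)

lemma absolutelyContinuous_of_renyiDiv_ne_top {p : ℝ} {μ ν : Measure α}
    (h : renyiDiv p μ ν ≠ ⊤) : μ ≪ ν := by
  by_contra hac
  simp [renyiDiv, hac] at h

lemma renyiDiv_ne_bot (p : ℝ) (μ ν : Measure α) : renyiDiv p μ ν ≠ ⊥ := by
  unfold renyiDiv
  split_ifs
  · exact EReal.coe_ne_bot _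
  · exact top_ne_bot
  · exact EReal.coe_ne_bot _
  · exact top_ne_bot

lemma renyiMoment_le_of_renyiDiv_le {p : ℝ} (hp : 1 < p) {μ ν : Measure α} {c : ℝ}
    (h : renyiDiv p μ ν ≤ c) : renyiMoment p μ ν ≤ ENNReal.ofReal (Real.exp ((p - 1) * c)) := by
  have hac := absolutelyContinuous_of_renyiDiv_ne_top (h.trans_lt (EReal.coe_lt_top c)).ne
  by_cases htop : renyiMoment p μ ν = ∞
  · have htop' : ∫⁻ x, (μ.rnDeriv ν x) ^ p ∂ν = ∞ := htop
    simp [renyiDiv, hac, hp.ne', htop'] at h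
  · have htop' : ∫⁻ x, (μ.rnDeriv ν x) ^ p ∂ν ≠ ∞ := htop
    rw [renyiDiv, if_pos hac, if_neg hp.ne', if_neg htop', EReal.coe_le_coe_iff,
      inv_mul_le_iff₀ (by linarith)] at h
    rw [ENNReal.le_ofReal_iff_toReal_le htop (Real.exp_nonneg _)]
    exact (Real.le_exp_log _).trans (Real.exp_le_exp.mpr h)

lemma renyiDiv_le_of_renyiMoment_le {p : ℝ} (hp : 1 < p) {μ ν : Measure α} [NeZero μ]
    [SigmaFinite μ] [SigmaFinite ν] (hac : μ ≪ ν) {c : ℝ}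
    (h : renyiMoment p μ ν ≤ ENNReal.ofReal (Real.exp ((p - 1) * c))) : renyiDiv p μ ν ≤ c := by
  have htop : renyiMoment p μ ν ≠ ∞ := (h.trans_lt ENNReal.ofReal_lt_top).ne
  have htop' : ∫⁻ x, (μ.rnDeriv ν x) ^ p ∂ν ≠ ∞ := htop
  rw [renyiDiv, if_pos hac, if_neg hp.ne', if_neg htop', EReal.coe_le_coe_iff,
    inv_mul_le_iff₀ (by linarith)]
  have hpos := ENNReal.toReal_pos (renyiMoment_ne_zero (by linarith : 0 < p) hac) htop
  exact (Real.log_le_iff_le_exp hpos).mpr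
    ((ENNReal.le_ofReal_iff_toReal_le htop (Real.exp_nonneg _)).mp h)

end Moment

/-- Law of the `i`-th coordinate of a random vector given the coordinates before it. -/
noncomputable abbrev condDistribCoord {Ω : Type*} [MeasurableSpace Ω] (P : Measure Ω)
    [IsFiniteMeasure P] {k : ℕ} (X : Ω → (Fin k → ℝ)) (i : Fin k) :
    Kernel (Fin i.val → ℝ) ℝ :=
  condDistrib (fun ω => X ω i) (fun ω (j : Fin i.val) => X ω (Fin.castLE i.isLt.le j)) P

lemma map_eq_map_compProd_condDistribCoord_last {Ω : Type*} [MeasurableSpace Ω] (P : Measure Ω)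
    [IsFiniteMeasure P] {k : ℕ} {X : Ω → (Fin (k + 1) → ℝ)} (hX : Measurable X) :
    P.map X = ((P.map fun ω j ↦ X ω (Fin.castSucc j)) ⊗ₘ
      condDistribCoord P X (Fin.last k)).map
        (MeasurableEquiv.prodComm.trans
          (MeasurableEquiv.piFinSuccAbove (fun _ ↦ ℝ) (Fin.last k)).symm) := by
  have h := compProd_map_condDistrib (mβ := MeasurableSpace.pi) (μ := P) (X := fun ω (j : Fin k) ↦ X ω (Fin.castSucc j))
    (Y := fun ω ↦ X ω (Fin.last k)) (by fun_prop)
  refine Eq.trans ?_ (congrArg (Measure.map _) h.symm)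
  rw [Measure.map_map (MeasurableEquiv.measurable _) (by fun_prop)]
  congr 1
  ext ω j
  refine Fin.lastCases ?_ (fun j ↦ ?_) j <;>
    simp [MeasurableEquiv.piFinSuccAbove, Fin.insertNthEquiv, MeasurableEquiv.prodComm]

lemma renyiMoment_map_le_prod {Ω : Type*} [MeasurableSpace Ω] (P : Measure Ω)
    [IsProbabilityMeasure P] {p : ℝ} (hp : 0 ≤ p) (k : ℕ) (X Y : Ω → (Fin k → ℝ))
    (hX : Measurable X) (hY : Measurable Y) (C : Fin k → ℝ≥0∞)
    (hac : ∀ i x, condDistribCoord P X i x ≪ condDistribCoord P Y i x)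
    (hC : ∀ i x, renyiMoment p (condDistribCoord P X i x) (condDistribCoord P Y i x) ≤ C i) :
    P.map X ≪ P.map Y ∧ renyiMoment p (P.map X) (P.map Y) ≤ ∏ i, C i := by
  induction k with
  | zero =>
    have hXY : X = Y := Subsingleton.elim _ _
    have := Measure.isProbabilityMeasure_map (μ := P) hY.aemeasurable
    subst hXY
    exact ⟨Measure.AbsolutelyContinuous.rfl, by simp [renyiMoment_self]⟩
  | succ k ih =>
    obtain ⟨ih1, ih2⟩ := ih (fun ω j ↦ X ω (Fin.castSucc j)) (fun ω j ↦ Y ω (Fin.castSucc j))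
      (by fun_prop) (by fun_prop) (fun i ↦ C i.castSucc) (fun i ↦ hac i.castSucc)
      (fun i ↦ hC i.castSucc)
    rw [map_eq_map_compProd_condDistribCoord_last P hX,
      map_eq_map_compProd_condDistribCoord_last P hY, renyiMoment_map _ _
        (MeasurableEquiv.measurableEmbedding _), Fin.prod_univ_castSucc]
    refine ⟨(Measure.AbsolutelyContinuous.compProd ih1
      (Filter.Eventually.of_forall (hac (Fin.last k)))).map (MeasurableEquiv.measurable _), ?_⟩
    exact (renyiMoment_compProd_le hp ih1 (hac (Fin.last k)) (hC (Fin.last k))).trans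
      (mul_le_mul_left ih2 _)

/-- **Strong composition for the Rényi divergence**: for `α > 1` and random vectors
`X, Y : Ω → (Fin k → ℝ)`, the divergence between the joint laws is at most the sum over
coordinates of the supremum over histories of the divergence between the regular conditional
distributions of the `i`-th coordinate given the first `i-1` coordinates. -/
theorem renyiDiv_strong_composition {Ω : Type*} [MeasurableSpace Ω]
    (P : Measure Ω) [IsProbabilityMeasure P] (k : ℕ)
    (X Y : Ω → (Fin k → ℝ)) (hX : Measurable X) (hY : Measurable Y)
    (α : ℝ) (hα : 1 < α) :
    renyiDiv α (P.map X) (P.map Y) ≤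
      ∑ i : Fin k, ⨆ x : (Fin i.val → ℝ),
        renyiDiv α
          (ProbabilityTheory.condDistrib (fun ω => X ω i)
            (fun ω (j : Fin i.val) => X ω (Fin.castLE i.isLt.le j)) P x)
          (ProbabilityTheory.condDistrib (fun ω => Y ω i)
            (fun ω (j : Fin i.val) => Y ω (Fin.castLE i.isLt.le j)) P x) := by
  have hbot (i : Fin k) : (⨆ x, renyiDiv α (condDistribCoord P X i x)
      (condDistribCoord P Y i x)) ≠ ⊥ := fun h ↦
    renyiDiv_ne_bot _ _ _ (iSup_eq_bot.mp h 0)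
  by_cases htop : ∃ i : Fin k, (⨆ x, renyiDiv α (condDistribCoord P X i x)
      (condDistribCoord P Y i x)) = ⊤
  · obtain ⟨i, hi⟩ := htop
    refine le_top.trans_eq (Eq.symm ?_)
    rw [← Finset.add_sum_erase _ _ (Finset.mem_univ i)]
    refine (congrArg (· + _) hi).trans (EReal.top_add_of_ne_bot ?_)
    refine Finset.sum_induction _ (· ≠ ⊥) (fun a b ha hb ↦ ?_) (by simp) (fun j _ ↦ hbot j)
    simp [EReal.add_eq_bot_iff, ha, hb]
  push Not at htop
  choose c hc using fun i ↦ (⟨_, EReal.coe_toReal (htop i) (hbot i)⟩ : ∃ c : ℝ, (c : EReal) = _)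
  have hle (i : Fin k) (x : Fin i.val → ℝ) :
      renyiDiv α (condDistribCoord P X i x) (condDistribCoord P Y i x) ≤ c i :=
    (le_iSup (fun x ↦ renyiDiv α (condDistribCoord P X i x) (condDistribCoord P Y i x)) x).trans_eq
      (hc i).symm
  obtain ⟨hac, hM⟩ := renyiMoment_map_le_prod P (by linarith : 0 ≤ α) k X Y hX hY
    (fun i ↦ ENNReal.ofReal (Real.exp ((α - 1) * c i)))
    (fun i x ↦ absolutelyContinuous_of_renyiDiv_ne_top
      ((hle i x).trans_lt (EReal.coe_lt_top _)).ne)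
    (fun i x ↦ renyiMoment_le_of_renyiDiv_le hα (hle i x))
  rw [← ENNReal.ofReal_prod_of_nonneg fun i _ ↦ Real.exp_nonneg _, ← Real.exp_sum,
    ← Finset.mul_sum] at hM
  have := Measure.isProbabilityMeasure_map (μ := P) hX.aemeasurable
  refine (renyiDiv_le_of_renyiMoment_le hα hac hM).trans_eq ?_
  have hsum : ((∑ i, c i : ℝ) : EReal) = ∑ i, (c i : EReal) :=
    map_sum (⟨⟨((↑) : ℝ → EReal), EReal.coe_zero⟩, EReal.coe_add⟩ : ℝ →+ EReal) c Finset.univ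
  exact hsum.trans <| Finset.sum_congr rfl fun i _ ↦ hc i
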